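/- arXiv:2212.00189 — 3 statements merged into one kernel-verified Lean document; each statement's English description precedes it below -/
import Mathlib

section
/- Let ε ∈ (0,1) and let β be a positive integer such that ε·β is an integer with ε·β ≥ 1. Let G = (V,E) be a finite simple graph, let H ⊆ E, and let e ∈ E ∖ H be underfull w.r.t. H, i.e. deg_H(e) < (1−ε)·β. Then Φ(H ∪ {e}) ≥ Φ(H) + 1. -/
open Finset
open scoped Classical

/-- The degree of a vertex `v` in an edge set `H`: the number of edges of `H` incident to `v`. -/
noncomputable def degV {V : Type*} (H : Finset (Sym2 V)) (v : V) : ℕ :=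
  (H.filter (fun e => v ∈ e)).card

/-- The edge degree of an unordered pair `e = {u,w}` in an edge set `H`:
`deg_H(u) + deg_H(w)`. -/
noncomputable def degE {V : Type*} (H : Finset (Sym2 V)) (e : Sym2 V) : ℕ :=
  Sym2.lift ⟨fun u w => degV H u + degV H w, fun _ _ => add_comm _ _⟩ e

/-- `M` is a matching: its edges are non-loops and pairwise vertex-disjoint. -/
def IsMatching {V : Type*} (M : Finset (Sym2 V)) : Prop :=
  (∀ e ∈ M, ¬ e.IsDiag) ∧ ∀ e ∈ M, ∀ f ∈ M, e ≠ f → ∀ v : V, v ∈ e → v ∉ f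

/-- `matchNum F` = μ(F), the maximum size of a matching contained in the edge set `F`. -/
noncomputable def matchNum {V : Type*} (F : Finset (Sym2 V)) : ℕ :=
  F.powerset.sup (fun M => if IsMatching M then M.card else 0)

/-- The potential Φ(H) = Σ_v deg_H(v)·(β − 1/2) − Σ_{e∈H} deg_H(e). -/
noncomputable def pot {V : Type*} [Fintype V] (β : ℝ) (H : Finset (Sym2 V)) : ℝ :=
  (∑ v : V, (degV H v : ℝ) * (β - 1/2)) - ∑ e ∈ H, (degE H e : ℝ)

theorem degV_insert {V : Type*} {H : Finset (Sym2 V)} {e : Sym2 V} (he : e ∉ H) (v : V) :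
    degV (insert e H) v = degV H v + if v ∈ e then 1 else 0 := by
  unfold degV
  rw [filter_insert]
  split_ifs with h
  · rw [card_insert_of_notMem (by simp [he])]
  · rfl

theorem degV_eq_sum {V : Type*} (H : Finset (Sym2 V)) (v : V) :
    degV H v = ∑ f ∈ H, if v ∈ f then 1 else 0 :=
  card_filter _ _

theorem sum_degV_insert {V : Type*} [Fintype V] {H : Finset (Sym2 V)} {e : Sym2 V}
    (he : e ∉ H) (hd : ¬ e.IsDiag) :
    ∑ v, degV (insert e H) v = ∑ v, degV H v + 2 := by
  simp only [degV_insert he, sum_add_distrib, ← card_filter]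
  induction e with | _ u w
  rw [Sym2.mk_isDiag_iff] at hd
  have : univ.filter (fun v => v ∈ s(u, w)) = {u, w} := by ext v; simp
  rw [this, card_pair hd]

theorem degE_insert_self {V : Type*} {H : Finset (Sym2 V)} {e : Sym2 V} (he : e ∉ H) :
    degE (insert e H) e = degE H e + 2 := by
  induction e with | _ u w
  simp only [degE, Sym2.lift_mk, degV_insert he, Sym2.mem_mk_left, Sym2.mem_mk_right, if_true]
  omega

/-- Inserting `e` raises the edge degrees in `H` by `degE H e` in total. -/
theorem sum_degE_insert {V : Type*} {H : Finset (Sym2 V)} {e : Sym2 V}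
    (hH : ∀ f ∈ H, ¬ f.IsDiag) (he : e ∉ H) (hd : ¬ e.IsDiag) :
    ∑ f ∈ H, degE (insert e H) f = ∑ f ∈ H, degE H f + degE H e := by
  have hself : degE H e =
      ∑ f ∈ H, (degE (insert e H) f - degE H f) := by
    induction e with | _ u w
    rw [Sym2.mk_isDiag_iff] at hd
    simp only [degE, Sym2.lift_mk]
    rw [degV_eq_sum, degV_eq_sum, ← sum_add_distrib]
    refine sum_congr rfl fun f hf => ?_
    have hfd := hH f hf
    induction f with | _ a b
    rw [Sym2.mk_isDiag_iff] at hfd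
    simp only [Sym2.lift_mk, degV_insert he, Sym2.mem_iff]
    grind
  rw [hself, ← sum_add_distrib]
  refine sum_congr rfl fun f _ => ?_
  induction f with | _ a b
  simp only [degE, Sym2.lift_mk, degV_insert he]
  omega

/-- The exact change of the potential when an edge is inserted. -/
theorem pot_insert {V : Type*} [Fintype V] (β : ℝ) {H : Finset (Sym2 V)} {e : Sym2 V}
    (hH : ∀ f ∈ H, ¬ f.IsDiag) (he : e ∉ H) (hd : ¬ e.IsDiag) :
    pot β (insert e H) = pot β H + (2 * β - 3 - 2 * degE H e) := by
  have h₁ : (∑ v, (degV (insert e H) v : ℝ)) = ∑ v, (degV H v : ℝ) + 2 :=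
    mod_cast sum_degV_insert he hd
  have h₂ : (∑ f ∈ H, (degE (insert e H) f : ℝ)) = ∑ f ∈ H, (degE H f : ℝ) + degE H e :=
    mod_cast sum_degE_insert hH he hd
  unfold pot
  rw [← sum_mul, ← sum_mul, h₁, sum_insert he, h₂, degE_insert_self he]
  push_cast
  ring

/-- inserting an underfull edge increases the potential by at least 1. -/
theorem pot_insert_underfull (V : Type) [Fintype V] (ε : ℝ) (β : ℕ)
    (hε : ε ∈ Set.Ioo (0 : ℝ) 1) (hβ : 0 < β)
    (k : ℕ) (hk : (k : ℝ) = ε * β) (hk1 : 1 ≤ k)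
    (E H : Finset (Sym2 V)) (hE : ∀ e ∈ E, ¬ e.IsDiag) (hHE : H ⊆ E)
    (e : Sym2 V) (heE : e ∈ E) (heH : e ∉ H)
    (hunder : (degE H e : ℝ) < (1 - ε) * β) :
    pot (β : ℝ) H + 1 ≤ pot (β : ℝ) (insert e H) := by
  have hlt : degE H e + k < β := by
    have : (degE H e : ℝ) + k < β := by linarith
    exact_mod_cast this
  have hle : (degE H e : ℝ) + 2 ≤ β := by
    have : degE H e + 2 ≤ β := by omega
    exact_mod_cast this
  rw [pot_insert _ (fun f hf => hE f (hHE hf)) heH (hE e heE)]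
  linarith
end

section
/- Let β > 0 be a real number and let H be the edge set of a finite simple graph in which every vertex has degree at most β. Then the number of edges satisfies |H| ≤ (3/2)·β·μ(H), where μ(H) is the maximum size of a matching contained in H. -/
open Finset
open scoped Classical

section MatchNum

variable {V : Type*} {H M N : Finset (Sym2 V)}

lemma IsMatching.card_le_matchNum (hM : IsMatching M) (h : M ⊆ H) : M.card ≤ matchNum H := by
  have := Finset.le_sup (f := fun M : Finset (Sym2 V) => if IsMatching M then M.card else 0)
    (Finset.mem_powerset.2 h)
  simpa [matchNum, hM] using this

lemma exists_isMatching_card_eq_matchNum (H : Finset (Sym2 V)) :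
    ∃ M ⊆ H, IsMatching M ∧ M.card = matchNum H := by
  obtain ⟨M, hM, h⟩ := Finset.exists_mem_eq_sup H.powerset ⟨∅, Finset.empty_mem_powerset H⟩
    (fun M : Finset (Sym2 V) => if IsMatching M then M.card else 0)
  by_cases hm : IsMatching M
  · exact ⟨M, Finset.mem_powerset.1 hM, hm, by rw [matchNum, h, if_pos hm]⟩
  · exact ⟨∅, Finset.empty_subset _, by simp [IsMatching], by rw [matchNum, h, if_neg hm]; rfl⟩

/-- Two matchings can be exchanged on a set `S` of vertices which is a union of connected
components of their union. -/
lemma IsMatching.exchange (hM : IsMatching M) (hN : IsMatching N) (S : Set V)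
    (hS : ∀ e ∈ M ∪ N, ∀ x ∈ e, ∀ y ∈ e, x ∈ S → y ∈ S) :
    IsMatching (M.filter (fun e => ¬ ∃ x ∈ e, x ∈ S) ∪ N.filter (fun e => ∃ x ∈ e, x ∈ S)) := by
  constructor
  · intro e he
    rcases Finset.mem_union.1 he with he | he
    · exact hM.1 e (Finset.mem_filter.1 he).1
    · exact hN.1 e (Finset.mem_filter.1 he).1
  · intro e he f hf hef v hve hvf
    simp only [Finset.mem_union, Finset.mem_filter] at he hf
    rcases he with ⟨he, he'⟩ | ⟨he, x, hx, hxS⟩ <;> rcases hf with ⟨hf, hf'⟩ | ⟨hf, y, hy, hyS⟩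
    · exact hM.2 e he f hf hef v hve hvf
    · exact he' ⟨v, hve, hS f (Finset.mem_union_right _ hf) y hy v hvf hyS⟩
    · exact hf' ⟨v, hvf, hS e (Finset.mem_union_right _ he) x hx v hve hxS⟩
    · exact hN.2 e he f hf hef v hve hvf

/-- Exchanging two maximum matchings on a union of connected components of their union yields a
maximum matching. -/
lemma card_exchange_eq_matchNum (hM : IsMatching M) (hN : IsMatching N) (hMH : M ⊆ H)
    (hNH : N ⊆ H) (hMc : M.card = matchNum H) (hNc : N.card = matchNum H) (S : Set V)
    (hS : ∀ e ∈ M ∪ N, ∀ x ∈ e, ∀ y ∈ e, x ∈ S → y ∈ S) :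
    (M.filter (fun e => ¬ ∃ x ∈ e, x ∈ S) ∪ N.filter (fun e => ∃ x ∈ e, x ∈ S)).card
      = matchNum H := by
  have key : ∀ A B : Finset (Sym2 V),
      (A.filter (fun e => ¬ ∃ x ∈ e, x ∈ S) ∪ B.filter (fun e => ∃ x ∈ e, x ∈ S)).card
      = (A.filter (fun e => ¬ ∃ x ∈ e, x ∈ S)).card
        + (B.filter (fun e => ∃ x ∈ e, x ∈ S)).card := by
    intro A B
    refine Finset.card_union_of_disjoint (Finset.disjoint_left.2 fun e he hf => ?_)
    exact (Finset.mem_filter.1 he).2 (Finset.mem_filter.1 hf).2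
  have hsub : ∀ A B : Finset (Sym2 V), A ⊆ H → B ⊆ H →
      A.filter (fun e => ¬ ∃ x ∈ e, x ∈ S) ∪ B.filter (fun e => ∃ x ∈ e, x ∈ S) ⊆ H :=
    fun A B hA hB => Finset.union_subset ((Finset.filter_subset _ _).trans hA)
      ((Finset.filter_subset _ _).trans hB)
  have h₁ := (hM.exchange hN S hS).card_le_matchNum (hsub M N hMH hNH)
  have h₂ := (hN.exchange hM S (by rwa [Finset.union_comm])).card_le_matchNum (hsub N M hNH hMH)
  have h₃ := M.card_filter_add_card_filter_not (fun e => ∃ x ∈ e, x ∈ S)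
  have h₄ := N.card_filter_add_card_filter_not (fun e => ∃ x ∈ e, x ∈ S)
  rw [key] at h₁ h₂ ⊢
  omega

lemma IsMatching.eq_of_mem_of_mem (hM : IsMatching M) {a x y : V} (hx : s(a, x) ∈ M)
    (hy : s(a, y) ∈ M) : x = y := by
  by_contra h
  refine hM.2 _ hx _ hy (fun he => h ?_) a (Sym2.mem_mk_left _ _) (Sym2.mem_mk_left _ _)
  exact Sym2.congr_right.1 he

lemma IsMatching.card_filter_mk_mem_le (hM : IsMatching M) (T : Finset V) (a : V) :
    (T.filter (fun x => s(a, x) ∈ M)).card ≤ 1 :=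
  Finset.card_le_one.2 fun _ hx _ hy =>
    hM.eq_of_mem_of_mem (Finset.mem_filter.1 hx).2 (Finset.mem_filter.1 hy).2

/-- A connected component of the union of two matchings cannot contain two vertices missed by
one matching together with a third vertex missed by the other. -/
lemma IsMatching.not_reachable_and_reachable (hM : IsMatching M) (hN : IsMatching N) {u v w : V}
    (huv : u ≠ v) (hvw : v ≠ w) (huw : u ≠ w) (hu : ∀ e ∈ M, u ∉ e) (hw : ∀ e ∈ M, w ∉ e)
    (hv : ∀ e ∈ N, v ∉ e) :
    ¬ ((SimpleGraph.fromEdgeSet (↑(M ∪ N) : Set (Sym2 V))).Reachable v u ∧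
      (SimpleGraph.fromEdgeSet (↑(M ∪ N) : Set (Sym2 V))).Reachable v w) := by
  rintro ⟨hvu, hvw'⟩
  set G := SimpleGraph.fromEdgeSet (↑(M ∪ N) : Set (Sym2 V)) with hG
  set S : Set V := (G.connectedComponentMk v).supp with hSdef
  have memS : ∀ x, x ∈ S ↔ G.Reachable v x := fun x => by
    rw [hSdef, SimpleGraph.ConnectedComponent.mem_supp_iff, SimpleGraph.ConnectedComponent.eq]
    exact ⟨fun h => h.symm, fun h => h.symm⟩
  have hfin : S.Finite := by
    refine (Finset.finite_toSet (insert v ((M ∪ N).biUnion fun e => e.toFinset))).subset ?_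
    intro x hx
    obtain ⟨p⟩ := ((memS x).1 hx).symm
    cases p with
    | nil => simp
    | cons h p =>
      rw [hG, SimpleGraph.fromEdgeSet_adj] at h
      simp only [Finset.coe_insert, Set.mem_insert_iff, Finset.mem_coe, Finset.mem_biUnion]
      exact Or.inr ⟨_, h.1, by simp⟩
  have : Fintype S := hfin.fintype
  have hconn : (G.induce S).Connected := (G.connectedComponentMk v).connected_toSimpleGraph
  have hcard := hconn.card_vert_le_card_edgeSet_add_one
  have hsum := (G.induce S).sum_degrees_eq_twice_card_edges
  rw [Nat.card_eq_fintype_card, Nat.card_eq_fintype_card, ← SimpleGraph.edgeFinset_card] at hcard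
  let T : Finset S := {⟨u, (memS u).2 hvu⟩, ⟨v, (memS v).2 (.refl v)⟩, ⟨w, (memS w).2 hvw'⟩}
  have hT : T.card = 3 := Finset.card_eq_three.2
    ⟨_, _, _, by simpa using huv, by simpa using huw, by simpa using hvw, rfl⟩
  have hdeg : ∀ s : S, (G.induce S).degree s + (if s ∈ T then 1 else 0) ≤ 2 := by
    intro s
    have hle : (G.induce S).degree s ≤
        (S.toFinset.filter (fun x => s(s.1, x) ∈ M)).card +
        (S.toFinset.filter (fun x => s(s.1, x) ∈ N)).card := by
      rw [← SimpleGraph.card_neighborFinset_eq_degree,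
        ← Finset.card_map (Function.Embedding.subtype _)]
      refine (Finset.card_le_card ?_).trans (Finset.card_union_le _ _)
      intro x hx
      simp only [Finset.mem_map, SimpleGraph.mem_neighborFinset, SimpleGraph.comap_adj, hG,
        SimpleGraph.fromEdgeSet_adj] at hx
      obtain ⟨y, hy, rfl⟩ := hx
      have := hy.1
      simp only [Finset.coe_union, Set.mem_union, Finset.mem_coe] at this
      simpa [← Finset.filter_or] using this
    have h₁ := hM.card_filter_mk_mem_le S.toFinset s
    have h₂ := hN.card_filter_mk_mem_le S.toFinset s
    have h₀ : ∀ {A : Finset (Sym2 V)}, (∀ e ∈ A, s.1 ∉ e) →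
        (S.toFinset.filter (fun x => s(s.1, x) ∈ A)).card = 0 := fun h =>
      Finset.card_eq_zero.2 (Finset.filter_eq_empty_iff.2 fun _ _ hx =>
        h _ hx (Sym2.mem_mk_left _ _))
    split_ifs with hs
    · simp only [T, Finset.mem_insert, Finset.mem_singleton] at hs
      rcases hs with rfl | rfl | rfl
      · have := h₀ hu
        omega
      · have := h₀ hv
        omega
      · have := h₀ hw
        omega
    · omega
  have := Finset.sum_le_sum fun s (_ : s ∈ (Finset.univ : Finset S)) => hdeg s
  rw [Finset.sum_add_distrib, hsum, Finset.sum_boole, Finset.filter_univ_mem, hT] at this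
  simp only [Finset.sum_const, smul_eq_mul, Finset.card_univ, Nat.cast_id] at this
  omega

/-- `M` is a maximum matching of `H`. -/
def IsMaxMatching (H M : Finset (Sym2 V)) : Prop :=
  M ⊆ H ∧ IsMatching M ∧ M.card = matchNum H

/-- **Gallai's lemma**, transitivity form. -/
lemma exists_isMaxMatching_missing_pair {u v w : V} (huv : u ≠ v) (hvw : v ≠ w) (huw : u ≠ w)
    (hM : IsMaxMatching H M) (hN : IsMaxMatching H N)
    (hu : ∀ e ∈ M, u ∉ e) (hw : ∀ e ∈ M, w ∉ e) (hv : ∀ e ∈ N, v ∉ e) :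
    ∃ L, IsMaxMatching H L ∧ (∀ e ∈ L, v ∉ e) ∧ ((∀ e ∈ L, u ∉ e) ∨ ∀ e ∈ L, w ∉ e) := by
  set G := SimpleGraph.fromEdgeSet (↑(M ∪ N) : Set (Sym2 V)) with hG
  let S : Set V := {x | G.Reachable v x}
  have hS : ∀ e ∈ M ∪ N, ∀ x ∈ e, ∀ y ∈ e, x ∈ S → y ∈ S := by
    intro e he x hx y hy hxS
    by_cases hxy : x = y
    · exact hxy ▸ hxS
    · have hadj : G.Adj x y := by
        rw [hG, SimpleGraph.fromEdgeSet_adj]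
        rw [(Sym2.mem_and_mem_iff hxy).1 ⟨hx, hy⟩] at he
        exact ⟨he, hxy⟩
      exact SimpleGraph.Reachable.trans hxS hadj.reachable
  refine ⟨M.filter (fun e => ¬ ∃ x ∈ e, x ∈ S) ∪ N.filter (fun e => ∃ x ∈ e, x ∈ S),
    ⟨Finset.union_subset ((Finset.filter_subset _ _).trans hM.1)
      ((Finset.filter_subset _ _).trans hN.1), hM.2.1.exchange hN.2.1 S hS,
      card_exchange_eq_matchNum hM.2.1 hN.2.1 hM.1 hN.1 hM.2.2 hN.2.2 S hS⟩, ?_, ?_⟩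
  · intro e he hve
    simp only [Finset.mem_union, Finset.mem_filter] at he
    rcases he with he | he
    · exact he.2 ⟨v, hve, SimpleGraph.Reachable.refl v⟩
    · exact hv e he.1 hve
  · have miss : ∀ z, z ∉ S → (∀ e ∈ M, z ∉ e) → ∀ e ∈ M.filter (fun e => ¬ ∃ x ∈ e, x ∈ S) ∪
        N.filter (fun e => ∃ x ∈ e, x ∈ S), z ∉ e := by
      intro z hz hzM e he hze
      simp only [Finset.mem_union, Finset.mem_filter] at he
      rcases he with he | ⟨he, x, hx, hxS⟩
      · exact hzM e he.1 hze
      · exact hz (hS e (Finset.mem_union_right _ he) x hx z hze hxS)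
    by_cases h : u ∈ S
    · refine Or.inr (miss w (fun h' => ?_) hw)
      exact hM.2.1.not_reachable_and_reachable hN.2.1 huv hvw huw hu hw hv ⟨h, h'⟩
    · exact Or.inl (miss u h hu)

lemma IsMaxMatching.not_missing_edge (hM : IsMaxMatching H M) (hH : ∀ e ∈ H, ¬ e.IsDiag)
    {u v : V} (huv : s(u, v) ∈ H) (hu : ∀ e ∈ M, u ∉ e) : ¬ ∀ e ∈ M, v ∉ e := by
  intro hv
  have hnot : s(u, v) ∉ M := fun h => hu _ h (Sym2.mem_mk_left _ _)
  have hdisj : ∀ f ∈ M, ∀ x ∈ f, x ∉ s(u, v) := by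
    intro f hf x hxf hx
    rcases Sym2.mem_iff.1 hx with rfl | rfl
    · exact hu f hf hxf
    · exact hv f hf hxf
  have hmatch : IsMatching (insert s(u, v) M) := by
    constructor
    · intro e he
      rcases Finset.mem_insert.1 he with rfl | he
      · exact hH _ huv
      · exact hM.2.1.1 e he
    · intro e he f hf hef x hxe hxf
      rcases Finset.mem_insert.1 he with rfl | he <;> rcases Finset.mem_insert.1 hf with rfl | hf
      · exact hef rfl
      · exact hdisj f hf x hxf hxe
      · exact hdisj e he x hxe hxf
      · exact hM.2.1.2 e he f hf hef x hxe hxf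
  have := hmatch.card_le_matchNum (Finset.insert_subset huv hM.1)
  rw [Finset.card_insert_of_notMem hnot, hM.2.2] at this
  omega

/-- If every vertex is missed by some maximum matching, then `H` is incident to at most `3 μ(H)`
vertices. -/
lemma card_biUnion_toFinset_le_three_mul_matchNum (hH : ∀ e ∈ H, ¬ e.IsDiag)
    (hmiss : ∀ v : V, ∃ M, IsMaxMatching H M ∧ ∀ e ∈ M, v ∉ e) :
    (H.biUnion fun e => e.toFinset).card ≤ 3 * matchNum H := by
  obtain ⟨M, hM⟩ : ∃ M, IsMaxMatching H M := exists_isMatching_card_eq_matchNum H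
  have trans : ∀ {u v w : V}, (∀ L, IsMaxMatching H L → (∀ e ∈ L, u ∉ e) → ¬ ∀ e ∈ L, v ∉ e) →
      (∀ L, IsMaxMatching H L → (∀ e ∈ L, v ∉ e) → ¬ ∀ e ∈ L, w ∉ e) → u ≠ w →
      ∀ L, IsMaxMatching H L → (∀ e ∈ L, u ∉ e) → ¬ ∀ e ∈ L, w ∉ e := by
    intro u v w h₁ h₂ huw L hL hu hw
    obtain ⟨N, hN, hv⟩ := hmiss v
    have huv : u ≠ v := by
      rintro rfl
      exact h₁ N hN hv hv
    have hvw : v ≠ w := by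
      rintro rfl
      exact h₂ N hN hv hv
    obtain ⟨K, hK, hKv, hKu | hKw⟩ :=
      exists_isMaxMatching_missing_pair huv hvw huw hL hN hu hw hv
    · exact h₁ K hK hKu hKv
    · exact h₂ K hK hKv hKw
  have edge : ∀ {u v : V}, s(u, v) ∈ H →
      ∀ L, IsMaxMatching H L → (∀ e ∈ L, u ∉ e) → ¬ ∀ e ∈ L, v ∉ e :=
    fun huv L hL => hL.not_missing_edge hH huv
  set W := H.biUnion fun e => e.toFinset with hW
  set U := W.filter fun v => ∀ e ∈ M, v ∉ e with hU
  have hf : ∀ w ∈ U, ∃ e ∈ M, ∃ x ∈ e, s(w, x) ∈ H := by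
    intro w hw
    obtain ⟨hw, hwM⟩ := Finset.mem_filter.1 hw
    obtain ⟨e, he, hwe⟩ := Finset.mem_biUnion.1 hw
    obtain ⟨x, rfl⟩ := Sym2.mem_toFinset.1 hwe
    have := hM.not_missing_edge hH he hwM
    push Not at this
    obtain ⟨f, hf, hxf⟩ := this
    exact ⟨f, hf, x, hxf, he⟩
  rcases isEmpty_or_nonempty V with hV | hV
  · simp [Finset.eq_empty_of_isEmpty W]
  have : Nonempty (Sym2 V) := hV.map fun v => s(v, v)
  choose! f hfM hfx using hf
  have hUle : U.card ≤ M.card := by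
    refine Finset.card_le_card_of_injOn f hfM ?_
    intro w hw w' hw' hww
    by_contra hne
    obtain ⟨x, hx, hwx⟩ := hfx w hw
    obtain ⟨y, hy, hwy⟩ := hfx w' hw'
    rw [← hww] at hy
    rw [Sym2.eq_swap] at hwy
    refine trans (edge hwx) ?_ hne M hM (Finset.mem_filter.1 hw).2 (Finset.mem_filter.1 hw').2
    by_cases hxy : x = y
    · subst hxy
      exact edge hwy
    · have hxyH : s(x, y) ∈ H := by
        rw [← (Sym2.mem_and_mem_iff hxy).1 ⟨hx, hy⟩]
        exact hM.1 (hfM w hw)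
      by_cases hxw : x = w'
      · subst hxw
        exact absurd hx ((Finset.mem_filter.1 hw').2 _ (hfM w hw))
      · exact trans (edge hxyH) (edge hwy) hxw
  have hcov : W ⊆ (M.biUnion fun e => e.toFinset) ∪ U := by
    intro v hv
    by_cases h : ∀ e ∈ M, v ∉ e
    · exact Finset.mem_union_right _ (Finset.mem_filter.2 ⟨hv, h⟩)
    · push Not at h
      obtain ⟨e, he, hve⟩ := h
      exact Finset.mem_union_left _ (Finset.mem_biUnion.2 ⟨e, he, Sym2.mem_toFinset.2 hve⟩)
  have h₁ : (M.biUnion fun e => e.toFinset).card ≤ M.card * 2 :=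
    Finset.card_biUnion_le_card_mul _ _ _ fun e he =>
      (Sym2.card_toFinset_of_not_isDiag e (hM.2.1.1 e he)).le
  have h₂ := (Finset.card_le_card hcov).trans (Finset.card_union_le _ _)
  have h₃ := hM.2.2
  omega

lemma sum_degV_eq_two_mul_card (hH : ∀ e ∈ H, ¬ e.IsDiag) :
    ∑ v ∈ H.biUnion (fun e => e.toFinset), degV H v = 2 * H.card := by
  simp only [degV]
  have := Finset.sum_card_bipartiteAbove_eq_sum_card_bipartiteBelow
    (s := H.biUnion fun e => e.toFinset) (t := H) (fun (v : V) e => v ∈ e)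
  simp only [Finset.bipartiteAbove, Finset.bipartiteBelow] at this
  rw [this, mul_comm, ← smul_eq_mul, ← Finset.sum_const]
  refine Finset.sum_congr rfl fun e he => ?_
  rw [← Sym2.card_toFinset_of_not_isDiag e (hH e he)]
  congr 1
  ext v
  simp only [Finset.mem_filter, Finset.mem_biUnion, Sym2.mem_toFinset]
  exact ⟨fun h => h.2, fun h => ⟨⟨e, he, h⟩, h⟩⟩

/-- Deleting a vertex covered by every maximum matching decreases the matching number. -/
lemma matchNum_filter_notMem_lt {v : V}
    (hv : ∀ M, IsMaxMatching H M → ¬ ∀ e ∈ M, v ∉ e) :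
    matchNum (H.filter fun e => v ∉ e) < matchNum H := by
  obtain ⟨M, hMH, hM, hc⟩ := exists_isMatching_card_eq_matchNum (H.filter fun e => v ∉ e)
  have hsub := hMH.trans (Finset.filter_subset _ _)
  rw [← hc]
  refine (hM.card_le_matchNum hsub).lt_of_ne fun h => ?_
  exact hv M ⟨hsub, hM, h⟩ fun e he => (Finset.mem_filter.1 (hMH he)).2

end MatchNum

/-- if every vertex has degree at most β in H, then |H| ≤ (3/2)·β·μ(H). -/
theorem card_le_maxdeg_mul_matchNum (V : Type) (β : ℝ) (hβ : 0 < β)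
    (H : Finset (Sym2 V)) (hH : ∀ e ∈ H, ¬ e.IsDiag)
    (hdeg : ∀ v : V, (degV H v : ℝ) ≤ β) :
    (H.card : ℝ) ≤ 3/2 * β * matchNum H := by
  induction hn : matchNum H using Nat.strong_induction_on generalizing H with
  | _ n ih =>
  by_cases hmiss : ∀ v : V, ∃ M, IsMaxMatching H M ∧ ∀ e ∈ M, v ∉ e
  · have h₁ : (2 * H.card : ℝ) ≤ (H.biUnion fun e => e.toFinset).card * β := by
      have h := Finset.sum_le_card_nsmul (H.biUnion fun e => e.toFinset)
        (fun v => (degV H v : ℝ)) β fun v _ => hdeg v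
      rw [← Nat.cast_sum, sum_degV_eq_two_mul_card hH, nsmul_eq_mul] at h
      exact_mod_cast h
    have h₂ : ((H.biUnion fun e => e.toFinset).card : ℝ) ≤ 3 * n := by
      have h := card_biUnion_toFinset_le_three_mul_matchNum hH hmiss
      rw [hn] at h
      exact_mod_cast h
    have := mul_le_mul_of_nonneg_right h₂ hβ.le
    linarith
  · push Not at hmiss
    obtain ⟨v, hv⟩ := hmiss
    have hlt : matchNum (H.filter fun e => v ∉ e) < matchNum H :=
      matchNum_filter_notMem_lt fun M hM h => by
        obtain ⟨e, he, hve⟩ := hv M hM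
        exact h e he hve
    have hle := ih _ (hn ▸ hlt) (H.filter fun e => v ∉ e)
      (fun e he => hH e (Finset.mem_filter.1 he).1)
      (fun w => le_trans (Nat.cast_le.2 (Finset.card_le_card
        (Finset.filter_subset_filter _ (Finset.filter_subset _ _)))) (hdeg w)) rfl
    have hsplit : (H.card : ℝ) = degV H v + (H.filter fun e => v ∉ e).card := by
      rw [degV, ← Nat.cast_add, Finset.card_filter_add_card_filter_not]
    have hstep : (matchNum (H.filter fun e => v ∉ e) : ℝ) + 1 ≤ n := by
      rw [hn] at hlt
      exact_mod_cast hlt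
    have := mul_le_mul_of_nonneg_left hstep hβ.le
    have := hdeg v
    linarith
end

section
/- Let G = (V,E) be a finite simple graph and let f : E → ℝ be a fractional matching, i.e. f(e) ≥ 0 for every e ∈ E and Σ_{e ∈ E, v ∈ e} f(e) ≤ 1 for every vertex v ∈ V. Then Σ_{e∈E} f(e) ≤ (3/2)·μ(G). -/
open Finset
open scoped Classical

/-- The size of any matching contained in `F` is at most `matchNum F`. -/
lemma IsMatching.card_le_matchNum_s5 {V : Type*} {M F : Finset (Sym2 V)} (hM : IsMatching M)
    (hMF : M ⊆ F) : M.card ≤ matchNum F := by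
  have h := Finset.le_sup (f := fun M : Finset (Sym2 V) => if IsMatching M then M.card else 0)
    (Finset.mem_powerset.2 hMF)
  simpa [matchNum, hM] using h

/-- A matching can be extended by a non-loop that is disjoint from all its edges. -/
lemma IsMatching.insert_edge {V : Type*} {M : Finset (Sym2 V)} (hM : IsMatching M) {e : Sym2 V}
    (he : ¬ e.IsDiag) (hd : ∀ f ∈ M, ∀ v ∈ e, v ∉ f) : IsMatching (insert e M) := by
  refine ⟨fun f hf => ?_, fun f hf g hg hfg v hvf hvg => ?_⟩
  · rcases Finset.mem_insert.1 hf with rfl | hf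
    exacts [he, hM.1 f hf]
  · rcases Finset.mem_insert.1 hf with rfl | hfM <;> rcases Finset.mem_insert.1 hg with rfl | hgM
    · exact hfg rfl
    · exact hd g hgM v hvf hvg
    · exact hd f hfM v hvg hvf
    · exact hM.2 f hfM g hgM hfg v hvf hvg

/-- In a set of arcs with in- and outdegrees at most one, at most three arcs meet a given arc,
itself included. -/
lemma card_filter_meet_le_three {V : Type*} {A : Finset (V × V)}
    (h₁ : Set.InjOn Prod.fst (A : Set (V × V))) (h₂ : Set.InjOn Prod.snd (A : Set (V × V)))
    {b : V × V} (hb : b ∈ A) :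
    (A.filter fun a => ∃ v ∈ s(a.1, a.2), v ∈ s(b.1, b.2)).card ≤ 3 := by
  have hsub : (A.filter fun a => ∃ v ∈ s(a.1, a.2), v ∈ s(b.1, b.2)) ⊆
      ({b} ∪ A.filter (fun a => a.1 = b.2)) ∪ A.filter (fun a => a.2 = b.1) := by
    intro a ha
    obtain ⟨haA, v, hva, hvb⟩ := Finset.mem_filter.1 ha
    simp only [Finset.mem_union, Finset.mem_singleton, Finset.mem_filter]
    rcases Sym2.mem_iff.1 hva with rfl | rfl <;> rcases Sym2.mem_iff.1 hvb with h | h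
    · exact .inl (.inl (h₁ haA hb h))
    · exact .inl (.inr ⟨haA, h⟩)
    · exact .inr ⟨haA, h⟩
    · exact .inl (.inl (h₂ haA hb h))
  have hc₁ : (A.filter fun a => a.1 = b.2).card ≤ 1 :=
    Finset.card_le_one.2 fun a ha c hc => by
      rw [Finset.mem_filter] at ha hc
      exact h₁ ha.1 hc.1 (ha.2.trans hc.2.symm)
  have hc₂ : (A.filter fun a => a.2 = b.1).card ≤ 1 :=
    Finset.card_le_one.2 fun a ha c hc => by
      rw [Finset.mem_filter] at ha hc
      exact h₂ ha.1 hc.1 (ha.2.trans hc.2.symm)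
  have hu₁ := Finset.card_union_le ({b} ∪ A.filter (fun a => a.1 = b.2))
    (A.filter (fun a => a.2 = b.1))
  have hu₂ := Finset.card_union_le {b} (A.filter (fun a => a.1 = b.2))
  have hs := Finset.card_le_card hsub
  rw [Finset.card_singleton] at hu₂
  omega

/-- Orienting edges of `E` so that in- and outdegrees are at most one yields at most
`3 * matchNum E` arcs: a maximal matching among them meets every arc. -/
lemma card_arcs_le_three_mul_matchNum {V : Type*} {E : Finset (Sym2 V)}
    (hE : ∀ e ∈ E, ¬ e.IsDiag) {A : Finset (V × V)} (hA : ∀ a ∈ A, s(a.1, a.2) ∈ E)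
    (h₁ : Set.InjOn Prod.fst (A : Set (V × V))) (h₂ : Set.InjOn Prod.snd (A : Set (V × V))) :
    A.card ≤ 3 * matchNum E := by
  let I : Finset (Sym2 V) := A.image fun a => s(a.1, a.2)
  obtain ⟨M, hM, hmax⟩ := Finset.exists_max_image (I.powerset.filter IsMatching) Finset.card
    ⟨∅, by simp [IsMatching]⟩
  obtain ⟨hMI, hMm⟩ := Finset.mem_filter.1 hM
  rw [Finset.mem_powerset] at hMI
  have hIE : I ⊆ E := Finset.image_subset_iff.2 hA
  have hcover : A ⊆ M.biUnion fun e => A.filter fun a => ∃ v ∈ s(a.1, a.2), v ∈ e := by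
    intro a ha
    by_contra hna
    have hd : ∀ f ∈ M, ∀ v ∈ s(a.1, a.2), v ∉ f := fun f hf v hv hvf =>
      hna (Finset.mem_biUnion.2 ⟨f, hf, Finset.mem_filter.2 ⟨ha, v, hv, hvf⟩⟩)
    have haM : s(a.1, a.2) ∉ M := fun h => hd _ h a.1 (by simp) (by simp)
    have hle := hmax (insert s(a.1, a.2) M) (Finset.mem_filter.2
      ⟨Finset.mem_powerset.2 (Finset.insert_subset (Finset.mem_image_of_mem _ ha) hMI),
        hMm.insert_edge (hE _ (hA a ha)) hd⟩)
    rw [Finset.card_insert_of_notMem haM] at hle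
    omega
  calc A.card ≤ _ := Finset.card_le_card hcover
    _ ≤ M.card * 3 := Finset.card_biUnion_le_card_mul _ _ _ fun e he => by
      obtain ⟨b, hb, rfl⟩ := Finset.mem_image.1 (hMI he)
      exact card_filter_meet_le_three h₁ h₂ hb
    _ ≤ 3 * matchNum E := by
      have := hMm.card_le_matchNum_s5 (hMI.trans hIE)
      omega

/-- A nonnegative symmetric matrix `F` with row sums at most one is the upper left block of a
doubly stochastic matrix. -/
lemma fromBlocks_mem_doublyStochastic {W : Type*} [Fintype W] [DecidableEq W] {F : Matrix W W ℝ}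
    (h0 : ∀ u w, 0 ≤ F u w) (hsymm : ∀ u w, F u w = F w u) (h1 : ∀ u, ∑ w, F u w ≤ 1) :
    Matrix.fromBlocks F (Matrix.diagonal fun u => 1 - ∑ w, F u w)
      (Matrix.diagonal fun u => 1 - ∑ w, F u w) F ∈ doublyStochastic ℝ (W ⊕ W) := by
  have hcol : ∀ u, ∑ w, F w u = ∑ w, F u w := fun u =>
    Finset.sum_congr rfl fun w _ => hsymm w u
  rw [mem_doublyStochastic_iff_sum]
  refine ⟨?_, ?_, ?_⟩
  · rintro (u | u) (w | w)
    · exact h0 u w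
    · by_cases h : u = w <;> simp [h, h1]
    · by_cases h : u = w <;> simp [h, h1]
    · exact h0 u w
  · rintro (u | u) <;> simp [Matrix.diagonal_apply]
  · rintro (u | u) <;> simp [Matrix.diagonal_apply, hcol]

/-- If every permutation matrix has at most `c` ones among the positions in `P`, then the entries of
a doubly stochastic matrix in `P` sum to at most `c`. -/
lemma sum_le_of_mem_doublyStochastic {n : Type*} [Fintype n] [DecidableEq n] {D : Matrix n n ℝ}
    (hD : D ∈ doublyStochastic ℝ n) (P : Finset (n × n)) {c : ℝ}
    (hc : ∀ σ : Equiv.Perm n, ((P.filter fun p => σ p.1 = p.2).card : ℝ) ≤ c) :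
    ∑ p ∈ P, D p.1 p.2 ≤ c := by
  obtain ⟨w, hw0, hw1, rfl⟩ := exists_eq_sum_perm_of_mem_doublyStochastic hD
  calc ∑ p ∈ P, (∑ σ, w σ • σ.permMatrix ℝ) p.1 p.2
      = ∑ σ, w σ * (P.filter fun p => σ p.1 = p.2).card := by
        simp only [Matrix.sum_apply, Matrix.smul_apply, smul_eq_mul]
        rw [Finset.sum_comm]
        refine Finset.sum_congr rfl fun σ _ => ?_
        rw [← Finset.mul_sum, Finset.card_filter]
        push_cast
        simp [Equiv.Perm.permMatrix, PEquiv.toMatrix_apply, Equiv.toPEquiv_apply]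
    _ ≤ ∑ σ, w σ * c := Finset.sum_le_sum fun σ _ => mul_le_mul_of_nonneg_left (hc σ) (hw0 σ)
    _ = c := by rw [← Finset.sum_mul, hw1, one_mul]

/-- The sum over the neighbours of `u` is the sum over the edges at `u`. -/
lemma sum_ite_mk_mem {V : Type*} (E : Finset (Sym2 V)) {S : Finset V}
    (hS : ∀ e ∈ E, ∀ v ∈ e, v ∈ S) (f : Sym2 V → ℝ) (u : V) :
    ∑ w : S, (if s(u, (w : V)) ∈ E then f s(u, (w : V)) else 0) =
      ∑ e ∈ E.filter (fun e => u ∈ e), f e := by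
  rw [← Finset.sum_filter]
  refine Finset.sum_bij (fun w _ => s(u, (w : V))) ?_ ?_ ?_ ?_
  · intro w hw
    simpa using hw
  · intro w _ w' _ h
    exact Subtype.ext (Sym2.congr_right.1 h)
  · intro e he
    obtain ⟨heE, hu⟩ := Finset.mem_filter.1 he
    obtain ⟨w, rfl⟩ := hu
    exact ⟨⟨w, hS _ heE w (by simp)⟩, by simpa using heE, rfl⟩
  · intros
    rfl

/-- Handshake identity for edge weights. -/
lemma sum_sum_filter_mem {V : Type*} {E : Finset (Sym2 V)} (hE : ∀ e ∈ E, ¬ e.IsDiag)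
    {S : Finset V} (hS : ∀ e ∈ E, ∀ v ∈ e, v ∈ S) (f : Sym2 V → ℝ) :
    ∑ u : S, ∑ e ∈ E.filter (fun e => (u : V) ∈ e), f e = 2 * ∑ e ∈ E, f e := by
  rw [Finset.sum_coe_sort S fun u => ∑ e ∈ E.filter (fun e => u ∈ e), f e]
  simp only [Finset.sum_filter]
  rw [Finset.sum_comm, Finset.mul_sum]
  refine Finset.sum_congr rfl fun e he => ?_
  have hfe : S.filter (fun v => v ∈ e) = e.toFinset := by
    ext v
    simpa using hS e he v
  rw [← Finset.sum_filter, hfe, Finset.sum_const, Sym2.card_toFinset_of_not_isDiag e (hE e he)]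
  simp

/-- any fractional matching of G has total value at most (3/2)·μ(G). -/
theorem fractional_matching_le (V : Type) (E : Finset (Sym2 V))
    (hE : ∀ e ∈ E, ¬ e.IsDiag) (f : Sym2 V → ℝ)
    (hf0 : ∀ e ∈ E, 0 ≤ f e)
    (hfv : ∀ v : V, ∑ e ∈ E.filter (fun e => v ∈ e), f e ≤ 1) :
    ∑ e ∈ E, f e ≤ 3/2 * matchNum E := by
  let S : Finset V := E.biUnion Sym2.toFinset
  have hS : ∀ e ∈ E, ∀ v ∈ e, v ∈ S := fun e he v hv =>
    Finset.mem_biUnion.2 ⟨e, he, Sym2.mem_toFinset.2 hv⟩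
  let F : Matrix S S ℝ := fun u w => if s((u : V), (w : V)) ∈ E then f s((u : V), (w : V)) else 0
  have hrow : ∀ u : S, ∑ w, F u w = ∑ e ∈ E.filter (fun e => (u : V) ∈ e), f e := fun u =>
    sum_ite_mk_mem E hS f u
  have hD := fromBlocks_mem_doublyStochastic (F := F)
    (fun u w => by dsimp only [F]; split_ifs with h; exacts [hf0 _ h, le_rfl])
    (fun u w => by simp only [F, Sym2.eq_swap])
    (fun u => (hrow u).trans_le (hfv u))
  let Q : Finset (S × S) := Finset.univ.filter fun p => s((p.1 : V), (p.2 : V)) ∈ E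
  let ι : S × S ↪ (S ⊕ S) × (S ⊕ S) := Function.Embedding.inl.prodMap Function.Embedding.inl
  have hsum : ∑ p ∈ Q.map ι, Matrix.fromBlocks F (Matrix.diagonal fun u => 1 - ∑ w, F u w)
      (Matrix.diagonal fun u => 1 - ∑ w, F u w) F p.1 p.2 = 2 * ∑ e ∈ E, f e := by
    rw [Finset.sum_map, ← sum_sum_filter_mem hE hS, Finset.sum_filter, Fintype.sum_prod_type]
    refine Finset.sum_congr rfl fun u _ => ?_
    rw [← hrow]
    refine Finset.sum_congr rfl fun w _ => ?_
    by_cases h : s((u : V), (w : V)) ∈ E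
    · rw [if_pos h]
      rfl
    · simp [F, h]
  have hle := sum_le_of_mem_doublyStochastic hD (Q.map ι) (c := 3 * matchNum E) fun σ => by
    let A : Finset (S × S) := Q.filter fun p => σ (.inl p.1) = .inl p.2
    let κ : S × S ↪ V × V := (Function.Embedding.subtype _).prodMap (Function.Embedding.subtype _)
    have hcard : ((Q.map ι).filter fun p => σ p.1 = p.2).card = (A.map κ).card := by
      rw [Finset.filter_map, Finset.card_map, Finset.card_map]
      rfl
    rw [hcard]
    have hA : ∀ p ∈ A, s((p.1 : V), (p.2 : V)) ∈ E ∧ σ (.inl p.1) = .inl p.2 := fun p hp => by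
      simpa [A, Q] using hp
    refine mod_cast card_arcs_le_three_mul_matchNum hE (A := A.map κ) ?_ ?_ ?_
    · intro a ha
      obtain ⟨p, hp, rfl⟩ := Finset.mem_map.1 ha
      exact (hA p hp).1
    · intro a ha b hb hab
      obtain ⟨p, hp, rfl⟩ := Finset.mem_map.1 ha
      obtain ⟨q, hq, rfl⟩ := Finset.mem_map.1 hb
      have h₁ : p.1 = q.1 := Subtype.ext hab
      have h₂ : p.2 = q.2 := Sum.inl_injective (β := S) <| by
        rw [← (hA p hp).2, ← (hA q hq).2, h₁]
      rw [Prod.ext h₁ h₂]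
    · intro a ha b hb hab
      obtain ⟨p, hp, rfl⟩ := Finset.mem_map.1 ha
      obtain ⟨q, hq, rfl⟩ := Finset.mem_map.1 hb
      have h₂ : p.2 = q.2 := Subtype.ext hab
      have h₁ : p.1 = q.1 := Sum.inl_injective (β := S) <| σ.injective <| by
        rw [(hA p hp).2, (hA q hq).2, h₂]
      rw [Prod.ext h₁ h₂]
  rw [hsum] at hle
  linarith
end
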